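/- Let κ satisfy the energy, consistency, and domination principles, and assume (A1) and (A2). Let A ⊂ X be arbitrary, let (U_j)_{j≥1} be an increasing sequence of Borel subsets of X with ⋃_j U_j = X, and set A_j := A ∩ U_j. Then for every μ ∈ E⁺: ‖μ^{A_j} − μ^A‖ → 0 as j → ∞, μ^{A_j} → μ^A vaguely, and κμ^{A_j}(x) → κμ^A(x) for quasi-every x ∈ X (i.e., for all x outside a set of outer capacity zero). -/

import Mathlib

open MeasureTheory Filter Topology Set
open scoped ENNReal NNReal

namespace Balayage

variable {X : Type*} [TopologicalSpace X] [T2Space X] [LocallyCompactSpace X]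
  [MeasurableSpace X] [BorelSpace X]

/-- The potential `κμ(x) := ∫ κ(x,y) dμ(y)`. -/
noncomputable def pot (κ : X → X → ℝ≥0∞) (μ : Measure X) (x : X) : ℝ≥0∞ :=
  ∫⁻ y, κ x y ∂μ

/-- The mutual energy `κ(μ,ν) := ∬ κ(x,y) d(μ⊗ν)(x,y)`. -/
noncomputable def energy (κ : X → X → ℝ≥0∞) (μ ν : Measure X) : ℝ≥0∞ :=
  ∫⁻ x, pot κ ν x ∂μ

/-- A positive Radon measure: locally finite and inner regular. -/
def IsRadon (μ : Measure X) : Prop :=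
  μ.InnerRegular ∧ IsLocallyFiniteMeasure μ

/-- `E⁺`: the positive Radon measures of finite energy. -/
def Eplus (κ : X → X → ℝ≥0∞) : Set (Measure X) :=
  {μ | IsRadon μ ∧ energy κ μ μ < ⊤}

/-- `μ` is concentrated on `A`: `A` is `μ`-measurable and `X∖A` is locally `μ`-negligible. -/
def ConcOn (μ : Measure X) (A : Set X) : Prop :=
  NullMeasurableSet A μ ∧ ∀ K : Set X, IsCompact K → μ (Aᶜ ∩ K) = 0

/-- `E⁺_A`: measures of finite energy concentrated on `A`. -/
def EplusOn (κ : X → X → ℝ≥0∞) (A : Set X) : Set (Measure X) :=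
  {μ ∈ Eplus κ | ConcOn μ A}

/-- The inner capacity `c_*(A)`. -/
noncomputable def innerCap (κ : X → X → ℝ≥0∞) (A : Set X) : ℝ≥0∞ :=
  (⨅ μ ∈ {μ ∈ EplusOn κ A | μ Set.univ = 1}, energy κ μ μ)⁻¹

/-- `P` holds nearly everywhere on `A`: the set where it fails has inner capacity zero. -/
def NEOn (κ : X → X → ℝ≥0∞) (A : Set X) (P : X → Prop) : Prop :=
  innerCap κ {x | x ∈ A ∧ ¬ P x} = 0

/-- The outer capacity `c^*(A)`. -/
noncomputable def outerCap (κ : X → X → ℝ≥0∞) (A : Set X) : ℝ≥0∞ :=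
  ⨅ D ∈ {D : Set X | IsOpen D ∧ A ⊆ D}, innerCap κ D

/-- `P` holds quasi-everywhere on `A`: the set where it fails has outer capacity zero. -/
def QEOn (κ : X → X → ℝ≥0∞) (A : Set X) (P : X → Prop) : Prop :=
  outerCap κ {x | x ∈ A ∧ ¬ P x} = 0

/-- The class `Λ_{A,μ}` of measures `ν ∈ E⁺` with `κν ≥ κμ` n.e. on `A`. -/
def InnerLam (κ : X → X → ℝ≥0∞) (A : Set X) (μ : Measure X) : Set (Measure X) :=
  {ν ∈ Eplus κ | NEOn κ A (fun x => pot κ μ x ≤ pot κ ν x)}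

/-- The class `Λ*_{A,μ}` of measures `ν ∈ E⁺` with `κν ≥ κμ` q.e. on `A`. -/
def OuterLam (κ : X → X → ℝ≥0∞) (A : Set X) (μ : Measure X) : Set (Measure X) :=
  {ν ∈ Eplus κ | QEOn κ A (fun x => pot κ μ x ≤ pot κ ν x)}

/-- `b` is the inner balayage `μ^A`: the measure of minimal potential in `Λ_{A,μ}`. -/
def IsInnerBal (κ : X → X → ℝ≥0∞) (A : Set X) (μ b : Measure X) : Prop :=
  b ∈ InnerLam κ A μ ∧ ∀ ν ∈ InnerLam κ A μ, ∀ x, pot κ b x ≤ pot κ ν x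

/-- `b` is the outer balayage `μ^{*A}`: the measure of minimal potential in `Λ*_{A,μ}`. -/
def IsOuterBal (κ : X → X → ℝ≥0∞) (A : Set X) (μ b : Measure X) : Prop :=
  b ∈ OuterLam κ A μ ∧ ∀ ν ∈ OuterLam κ A μ, ∀ x, pot κ b x ≤ pot κ ν x

/-- The strong (energy) distance `‖μ − ν‖`. -/
noncomputable def strDist (κ : X → X → ℝ≥0∞) (μ ν : Measure X) : ℝ :=
  Real.sqrt ((energy κ μ μ).toReal - 2 * (energy κ μ ν).toReal + (energy κ ν ν).toReal)

/-- The energy principle (strict positive definiteness). -/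
def EnergyPrinciple (κ : X → X → ℝ≥0∞) : Prop :=
  ∀ μ ∈ Eplus κ, ∀ ν ∈ Eplus κ,
    2 * energy κ μ ν ≤ energy κ μ μ + energy κ ν ν ∧
      (2 * energy κ μ ν = energy κ μ μ + energy κ ν ν → μ = ν)

/-- Vague convergence of a net of measures along a filter. -/
def VagueConv {ι : Type*} (F : Filter ι) (m : ι → Measure X) (ν : Measure X) : Prop :=
  ∀ f : X → ℝ, Continuous f → HasCompactSupport f →
    Tendsto (fun i => ∫ x, f x ∂(m i)) F (nhds (∫ x, f x ∂ν))

/-- A net of measures is strong Cauchy (for the energy metric) along a filter. -/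
def StrongCauchy (κ : X → X → ℝ≥0∞) {ι : Type*} (F : Filter ι) (m : ι → Measure X) : Prop :=
  ∀ ε : ℝ, 0 < ε → ∃ s ∈ F, ∀ i ∈ s, ∀ j ∈ s, strDist κ (m i) (m j) < ε

/-- The consistency principle: every strong Cauchy net in `E⁺` converges strongly
to each of its vague limit points. -/
def Consistent (κ : X → X → ℝ≥0∞) : Prop :=
  ∀ (ι : Type) (F : Filter ι) (m : ι → Measure X), F.NeBot →
    (∀ i, m i ∈ Eplus κ) → StrongCauchy κ F m →
    ∀ ν : Measure X, (∃ G : Filter ι, G ≤ F ∧ G.NeBot ∧ VagueConv G m ν) →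
      Tendsto (fun i => strDist κ (m i) ν) F (nhds 0)

/-- The domination principle. -/
def Domination (κ : X → X → ℝ≥0∞) : Prop :=
  ∀ μ ∈ Eplus κ, ∀ ν ∈ Eplus κ,
    (∀ᵐ x ∂μ, pot κ μ x ≤ pot κ ν x) → ∀ x, pot κ μ x ≤ pot κ ν x

/-- A kernel: symmetric and lower semicontinuous. -/
structure IsKernel (κ : X → X → ℝ≥0∞) : Prop where
  symm : ∀ x y, κ x y = κ y x
  lsc : LowerSemicontinuous (Function.uncurry κ)

/-- `E'_A`: the strong closure of `E⁺_A` within `E⁺`. -/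
def EclosOn (κ : X → X → ℝ≥0∞) (A : Set X) : Set (Measure X) :=
  {ν ∈ Eplus κ | ∀ ε : ℝ, 0 < ε → ∃ μ ∈ EplusOn κ A, strDist κ ν μ < ε}

/-- The (real-valued) potential of the signed measure `λ = lp − lm`. -/
noncomputable def spot (κ : X → X → ℝ≥0∞) (lp lm : Measure X) (x : X) : ℝ :=
  (pot κ lp x).toReal - (pot κ lm x).toReal

/-- Assumption (A2): every `f ∈ C_c(X)` is the limit, uniformly with supports in one fixed
compact set, of a sequence of potentials of signed measures of finite energy that are
continuous and compactly supported. -/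
def A2 (κ : X → X → ℝ≥0∞) : Prop :=
  ∀ f : X → ℝ, Continuous f → HasCompactSupport f →
    ∃ (K : Set X) (lp lm : ℕ → Measure X), IsCompact K ∧ tsupport f ⊆ K ∧
      (∀ j, lp j ∈ Eplus κ ∧ lm j ∈ Eplus κ) ∧
      (∀ j x, pot κ (lp j) x ≠ ⊤ ∨ pot κ (lm j) x ≠ ⊤) ∧
      (∀ j, Continuous (spot κ (lp j) (lm j))) ∧
      (∀ j, tsupport (spot κ (lp j) (lm j)) ⊆ K) ∧
      TendstoUniformly (fun j => spot κ (lp j) (lm j)) f atTop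


set_option linter.unusedSectionVars false

section Energy

variable [SecondCountableTopology X] {κ : X → X → ℝ≥0∞}

lemma isRadon_iff {μ : Measure X} : IsRadon μ ↔ IsLocallyFiniteMeasure μ := by
  refine ⟨fun h => h.2, fun h => ⟨?_, h⟩⟩
  have : TopologicalSpace.MetrizableSpace X := inferInstance
  let _ := TopologicalSpace.metrizableSpaceMetric X
  have : μ.Regular := inferInstance
  infer_instance

lemma isLocallyFiniteMeasure_of_mem {μ : Measure X} (h : μ ∈ Eplus κ) :
    IsLocallyFiniteMeasure μ := h.1.2

lemma IsKernel.measurable (hker : IsKernel κ) : Measurable (Function.uncurry κ) :=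
  hker.lsc.measurable

lemma measurable_pot (hker : IsKernel κ) (μ : Measure X) [SFinite μ] : Measurable (pot κ μ) :=
  hker.measurable.lintegral_prod_right'

lemma lowerSemicontinuous_pot (hker : IsKernel κ) (μ : Measure X) :
    LowerSemicontinuous (pot κ μ) := by
  rw [lowerSemicontinuous_iff_le_liminf]
  intro x
  have hm : ∀ x, Measurable (κ x) := fun x => hker.measurable.of_uncurry_left
  refine le_trans (lintegral_mono fun y => ?_) (lintegral_liminf_le hm)
  have hc : Continuous fun x : X => (x, y) := by fun_prop
  have h1 : LowerSemicontinuous (fun x => κ x y) := hker.lsc.comp hc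
  exact lowerSemicontinuous_iff_le_liminf.1 h1 x

lemma energy_comm (hker : IsKernel κ) (μ ν : Measure X) [SFinite μ] [SFinite ν] :
    energy κ μ ν = energy κ ν μ := by
  unfold energy pot
  rw [lintegral_lintegral_swap hker.measurable.aemeasurable]
  simp_rw [hker.symm]

lemma energy_mono_right {μ ν₁ ν₂ : Measure X} (h : ∀ x, pot κ ν₁ x ≤ pot κ ν₂ x) :
    energy κ μ ν₁ ≤ energy κ μ ν₂ := lintegral_mono h

lemma energy_mono {μ ν : Measure X} (h : μ ≤ ν) : energy κ μ μ ≤ energy κ ν ν :=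
  lintegral_mono' h fun _ => lintegral_mono' h le_rfl

lemma energy_add_left (μ₁ μ₂ ν : Measure X) :
    energy κ (μ₁ + μ₂) ν = energy κ μ₁ ν + energy κ μ₂ ν := lintegral_add_measure _ _ _

lemma energy_smul_left (c : ℝ≥0∞) (μ ν : Measure X) :
    energy κ (c • μ) ν = c * energy κ μ ν := lintegral_smul_measure _ _

lemma energy_smul_smul (c : ℝ≥0∞) (hc : c ≠ ⊤) (μ : Measure X) :
    energy κ (c • μ) (c • μ) = c ^ 2 * energy κ μ μ := by
  simp only [energy, pot, lintegral_smul_measure, smul_eq_mul]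
  rw [lintegral_const_mul' _ _ hc, sq, mul_assoc]

lemma energy_lt_top (hE : EnergyPrinciple κ) {μ ν : Measure X} (hμ : μ ∈ Eplus κ)
    (hν : ν ∈ Eplus κ) : energy κ μ ν < ⊤ := by
  have h := ((hE μ hμ ν hν).1).trans_lt (ENNReal.add_lt_top.2 ⟨hμ.2, hν.2⟩)
  by_contra h'
  rw [not_lt, top_le_iff] at h'
  simp [h'] at h

lemma restrict_mem_Eplus {μ : Measure X} (hμ : μ ∈ Eplus κ) (s : Set X) :
    μ.restrict s ∈ Eplus κ := by
  have := isLocallyFiniteMeasure_of_mem hμ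
  exact ⟨isRadon_iff.2 inferInstance, (energy_mono Measure.restrict_le_self).trans_lt hμ.2⟩

lemma smul_mem_Eplus {μ : Measure X} (hμ : μ ∈ Eplus κ) {c : ℝ≥0∞} (hc : c ≠ ⊤) :
    c • μ ∈ Eplus κ := by
  have := isLocallyFiniteMeasure_of_mem hμ
  refine ⟨isRadon_iff.2 ?_, ?_⟩
  · lift c to ℝ≥0 using hc
    exact inferInstanceAs (IsLocallyFiniteMeasure (c • μ))
  · rw [energy_smul_smul c hc]
    exact ENNReal.mul_lt_top (by finiteness) hμ.2

lemma energy_add_smul (hker : IsKernel κ) {μ ν : Measure X} (hμ : μ ∈ Eplus κ) (hν : ν ∈ Eplus κ)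
    {c : ℝ≥0∞} (hc : c ≠ ⊤) :
    energy κ (μ + c • ν) (μ + c • ν) =
      energy κ μ μ + 2 * c * energy κ ν μ + c ^ 2 * energy κ ν ν := by
  have := isLocallyFiniteMeasure_of_mem hμ
  have := isLocallyFiniteMeasure_of_mem hν
  have := isLocallyFiniteMeasure_of_mem (smul_mem_Eplus hν hc)
  rw [energy_add_left, energy_comm hker μ, energy_comm hker (c • ν) (μ + c • ν), energy_add_left,
    energy_add_left, energy_smul_smul c hc, energy_smul_left, energy_comm hker μ (c • ν),
    energy_smul_left]
  ring

lemma add_smul_mem_Eplus (hker : IsKernel κ) (hE : EnergyPrinciple κ) {μ ν : Measure X}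
    (hμ : μ ∈ Eplus κ) (hν : ν ∈ Eplus κ) {c : ℝ≥0∞} (hc : c ≠ ⊤) : μ + c • ν ∈ Eplus κ := by
  have := isLocallyFiniteMeasure_of_mem hμ
  have := isLocallyFiniteMeasure_of_mem (smul_mem_Eplus hν hc)
  refine ⟨isRadon_iff.2 ⟨fun x => ?_⟩, ?_⟩
  · obtain ⟨s, hs, h1⟩ := μ.finiteAt_nhds x
    obtain ⟨t, ht, h2⟩ := (c • ν).finiteAt_nhds x
    refine ⟨s ∩ t, inter_mem hs ht, ?_⟩
    rw [Measure.add_apply]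
    exact ENNReal.add_lt_top.2 ⟨(measure_mono inter_subset_left).trans_lt h1,
      (measure_mono inter_subset_right).trans_lt h2⟩
  · have h1 := hμ.2
    have h2 := hν.2
    have h3 := energy_lt_top hE hν hμ
    rw [energy_add_smul hker hμ hν hc]
    finiteness

lemma sq_strDist (hE : EnergyPrinciple κ) {μ ν : Measure X} (hμ : μ ∈ Eplus κ)
    (hν : ν ∈ Eplus κ) : strDist κ μ ν ^ 2 =
      (energy κ μ μ).toReal - 2 * (energy κ μ ν).toReal + (energy κ ν ν).toReal := by
  refine Real.sq_sqrt ?_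
  have h := ENNReal.toReal_mono (ENNReal.add_ne_top.2 ⟨hμ.2.ne, hν.2.ne⟩) (hE μ hμ ν hν).1
  rw [ENNReal.toReal_add hμ.2.ne hν.2.ne, ENNReal.toReal_mul] at h
  norm_num at h
  linarith

lemma strDist_comm (hker : IsKernel κ) {μ ν : Measure X} (hμ : μ ∈ Eplus κ)
    (hν : ν ∈ Eplus κ) : strDist κ μ ν = strDist κ ν μ := by
  have := isLocallyFiniteMeasure_of_mem hμ
  have := isLocallyFiniteMeasure_of_mem hν
  unfold strDist
  rw [energy_comm hker μ ν]
  congr 1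
  ring

lemma two_mul_energy_sub_le (hker : IsKernel κ) (hE : EnergyPrinciple κ) {α β ν : Measure X}
    (hα : α ∈ Eplus κ) (hβ : β ∈ Eplus κ) (hν : ν ∈ Eplus κ) {t : ℝ} (ht : 0 ≤ t) :
    2 * t * ((energy κ ν β).toReal - (energy κ ν α).toReal) ≤
      strDist κ α β ^ 2 + t ^ 2 * (energy κ ν ν).toReal := by
  lift t to ℝ≥0 using ht
  have hm := add_smul_mem_Eplus hker hE hα hν (ENNReal.coe_ne_top (r := t))
  have h := ENNReal.toReal_mono (ENNReal.add_ne_top.2 ⟨hm.2.ne, hβ.2.ne⟩) (hE _ hm β hβ).1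
  have h1 := hα.2.ne
  have h2 := hβ.2.ne
  have h3 := hν.2.ne
  have h4 := (energy_lt_top hE hν hα).ne
  have h5 := (energy_lt_top hE hν hβ).ne
  have h6 := (energy_lt_top hE hα hβ).ne
  rw [energy_add_smul hker hα hν ENNReal.coe_ne_top, energy_add_left, energy_smul_left,
    ENNReal.toReal_add (by finiteness) h2, ENNReal.toReal_add (by finiteness) (by finiteness),
    ENNReal.toReal_add (by finiteness) (by finiteness), ENNReal.toReal_mul,
    ENNReal.toReal_add (by finiteness) (by finiteness), ENNReal.toReal_mul, ENNReal.toReal_mul,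
    ENNReal.toReal_mul, ENNReal.toReal_mul, ENNReal.toReal_pow] at h
  simp only [ENNReal.toReal_ofNat, ENNReal.coe_toReal] at h
  rw [sq_strDist hE hα hβ]
  linarith

/-- Strong convergence implies weak convergence. -/
lemma tendsto_energy_of_strDist (hker : IsKernel κ) (hE : EnergyPrinciple κ) {ι : Type*}
    {F : Filter ι} {m : ι → Measure X} {β ν : Measure X} (hm : ∀ i, m i ∈ Eplus κ)
    (hβ : β ∈ Eplus κ) (hν : ν ∈ Eplus κ)
    (h : Tendsto (fun i => strDist κ (m i) β) F (𝓝 0)) :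
    Tendsto (fun i => energy κ ν (m i)) F (𝓝 (energy κ ν β)) := by
  rw [← ENNReal.tendsto_toReal_iff (fun i => (energy_lt_top hE hν (hm i)).ne)
    (energy_lt_top hE hν hβ).ne, Metric.tendsto_nhds]
  intro ε hε
  set e := (energy κ ν ν).toReal with he
  have he0 : 0 ≤ e := ENNReal.toReal_nonneg
  have ht : 0 < ε / (e + 1) := by positivity
  set t := ε / (e + 1) with htdef
  have hte : t * (e + 1) = ε := by rw [htdef]; field_simp
  have h2 : Tendsto (fun i => strDist κ (m i) β ^ 2) F (𝓝 0) := by simpa using h.pow 2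
  filter_upwards [h2.eventually (gt_mem_nhds (mul_pos ht hε))] with i hi
  have a1 := two_mul_energy_sub_le hker hE (hm i) hβ hν ht.le
  have a2 := two_mul_energy_sub_le hker hE hβ (hm i) hν ht.le
  rw [strDist_comm hker hβ (hm i)] at a2
  have hb : t ^ 2 * e ≤ t * ε := by rw [← hte]; nlinarith
  rw [Real.dist_eq, abs_lt]
  constructor <;> nlinarith

/-- Potentials are compared pointwise by testing against all measures of finite energy. -/
lemma pot_le_of_forall_energy_le (hker : IsKernel κ) (hD : Domination κ) {α β : Measure X}
    (hα : α ∈ Eplus κ) (hβ : β ∈ Eplus κ)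
    (h : ∀ ν ∈ Eplus κ, energy κ ν α ≤ energy κ ν β) (x : X) : pot κ α x ≤ pot κ β x := by
  have := isLocallyFiniteMeasure_of_mem hα
  have := isLocallyFiniteMeasure_of_mem hβ
  refine hD α hα β hβ ?_ x
  exact ae_le_of_forall_setLIntegral_le_of_sigmaFinite (measurable_pot hker α)
    fun s _ _ => h _ (restrict_mem_Eplus hα s)

lemma eq_of_pot_eq (hker : IsKernel κ) (hE : EnergyPrinciple κ) {α β : Measure X}
    (hα : α ∈ Eplus κ) (hβ : β ∈ Eplus κ) (h : ∀ x, pot κ α x = pot κ β x) : α = β := by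
  have := isLocallyFiniteMeasure_of_mem hα
  have := isLocallyFiniteMeasure_of_mem hβ
  have h' : ∀ ν, energy κ ν α = energy κ ν β := fun ν => lintegral_congr h
  refine (hE α hα β hβ).2 ?_
  rw [two_mul, h' α, ← h' β, energy_comm hker β α]

/-- Increasing potentials with bounded energies form a strong Cauchy sequence. -/
lemma strongCauchy_of_monotone_pot (hker : IsKernel κ) (hE : EnergyPrinciple κ)
    {m : ℕ → Measure X} (hm : ∀ i, m i ∈ Eplus κ) (hmono : ∀ x, Monotone fun i => pot κ (m i) x)
    {C : ℝ≥0∞} (hC : C ≠ ⊤) (hb : ∀ i, energy κ (m i) (m i) ≤ C) :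
    StrongCauchy κ atTop m := by
  have key : ∀ i j, i ≤ j → (energy κ (m i) (m i)).toReal ≤ (energy κ (m i) (m j)).toReal ∧
      (energy κ (m i) (m j)).toReal ≤ (energy κ (m j) (m j)).toReal := by
    intro i j hij
    have := isLocallyFiniteMeasure_of_mem (hm i)
    have := isLocallyFiniteMeasure_of_mem (hm j)
    refine ⟨ENNReal.toReal_mono (energy_lt_top hE (hm i) (hm j)).ne
      (energy_mono_right fun x => hmono x hij), ENNReal.toReal_mono (hm j).2.ne ?_⟩
    rw [energy_comm hker]
    exact energy_mono_right fun x => hmono x hij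
  have hmon : Monotone fun i => (energy κ (m i) (m i)).toReal :=
    fun i j hij => (key i j hij).1.trans (key i j hij).2
  have hcau : CauchySeq fun i => (energy κ (m i) (m i)).toReal :=
    (tendsto_atTop_ciSup hmon ⟨C.toReal, by
      rintro _ ⟨i, rfl⟩; exact ENNReal.toReal_mono hC (hb i)⟩).cauchySeq
  intro ε hε
  obtain ⟨N, hN⟩ := Metric.cauchySeq_iff.1 hcau (ε ^ 2) (by positivity)
  have main : ∀ i j, N ≤ i → i ≤ j → strDist κ (m i) (m j) < ε := by
    intro i j hi hij
    have h1 := hN i hi j (hi.trans hij)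
    have h2 := sq_strDist hE (hm i) (hm j)
    rw [Real.dist_eq, abs_lt] at h1
    refine lt_of_pow_lt_pow_left₀ 2 hε.le ?_
    have := (key i j hij).1
    linarith
  refine ⟨Ici N, Ici_mem_atTop N, fun i hi j hj => ?_⟩
  rcases le_total i j with h | h
  · exact main i j hi h
  · rw [strDist_comm hker (hm i) (hm j)]
    exact main j i hj h

end Energy

section Capacity

variable [SecondCountableTopology X] {κ : X → X → ℝ≥0∞}

lemma concOn_iff {μ : Measure X} {S : Set X} : ConcOn μ S ↔ μ Sᶜ = 0 := by
  refine ⟨fun h => ?_, fun h => ⟨?_, fun K _ => measure_mono_null inter_subset_left h⟩⟩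
  · rw [← inter_univ Sᶜ, ← iUnion_compactCovering, inter_iUnion, measure_iUnion_null_iff]
    exact fun n => h.2 _ (isCompact_compactCovering X n)
  · exact (NullMeasurableSet.of_null h).of_compl

lemma innerCap_eq_zero {S : Set X}
    (h : ∀ σ ∈ Eplus κ, σ univ = 1 → σ Sᶜ = 0 → False) : innerCap κ S = 0 := by
  rw [innerCap, ENNReal.inv_eq_zero]
  refine iInf₂_eq_top.2 fun σ hσ => ?_
  exact (h σ hσ.1.1 hσ.2 (concOn_iff.1 hσ.1.2)).elim

lemma sq_measure_mul_inv_innerCap_le {S B : Set X} {σ : Measure X} (hσ : σ ∈ Eplus κ)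
    (hB : MeasurableSet B) (h : σ (B ∩ Sᶜ) = 0) :
    σ B ^ 2 * (innerCap κ S)⁻¹ ≤ energy κ σ σ := by
  have := isLocallyFiniteMeasure_of_mem hσ
  have := hσ.1.1
  rw [hB.measure_eq_iSup_isCompact]
  simp only [ENNReal.iSup_pow_of_ne_zero two_ne_zero, ENNReal.iSup_mul]
  refine iSup₂_le fun K hKB => iSup_le fun hK => ?_
  by_cases h0 : σ K = 0
  · simp [h0]
  have hfin : σ K ≠ ⊤ := hK.measure_lt_top.ne
  have hc : (σ K)⁻¹ ≠ ⊤ := ENNReal.inv_ne_top.2 h0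
  have hmem := smul_mem_Eplus (restrict_mem_Eplus hσ K) hc
  have h1 : ((σ K)⁻¹ • σ.restrict K) univ = 1 := by
    simp [ENNReal.inv_mul_cancel h0 hfin]
  have h2 : ((σ K)⁻¹ • σ.restrict K) Sᶜ = 0 := by
    rw [Measure.smul_apply, Measure.restrict_apply' hK.measurableSet, inter_comm,
      measure_mono_null (inter_subset_inter_left _ hKB) h, smul_zero]
  rw [innerCap, inv_inv]
  calc σ K ^ 2 * ⨅ μ ∈ {μ ∈ EplusOn κ S | μ univ = 1}, energy κ μ μ
      ≤ σ K ^ 2 * ((σ K)⁻¹ ^ 2 * energy κ σ σ) := by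
        gcongr
        refine (iInf₂_le _ ⟨⟨hmem, concOn_iff.2 h2⟩, h1⟩).trans ?_
        rw [energy_smul_smul _ hc]
        gcongr
        exact energy_mono Measure.restrict_le_self
    _ = energy κ σ σ := by
        rw [← mul_assoc, ← mul_pow, ENNReal.mul_inv_cancel h0 hfin, one_pow, one_mul]

lemma measure_eq_zero_of_innerCap_eq_zero {S B : Set X} {σ : Measure X} (hσ : σ ∈ Eplus κ)
    (hB : MeasurableSet B) (hS : innerCap κ S = 0) (h : σ (B ∩ Sᶜ) = 0) : σ B = 0 := by
  have h1 := (sq_measure_mul_inv_innerCap_le hσ hB h).trans_lt hσ.2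
  rw [hS, ENNReal.inv_zero] at h1
  by_contra h0
  rw [ENNReal.mul_top (pow_ne_zero 2 h0)] at h1
  exact lt_irrefl _ h1

lemma innerCap_eq_zero_mono {S T : Set X} (hTS : T ⊆ S) (hS : innerCap κ S = 0) :
    innerCap κ T = 0 := by
  refine innerCap_eq_zero fun σ hσ h1 h0 => ?_
  have := measure_eq_zero_of_innerCap_eq_zero hσ MeasurableSet.univ hS
    (measure_mono_null (inter_subset_right.trans (compl_subset_compl.2 hTS)) h0)
  simp [this] at h1

/-- Countable unions of sets of outer capacity zero have outer capacity zero. -/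
lemma outerCap_iUnion_eq_zero {E : ℕ → Set X} (hE : ∀ n, outerCap κ (E n) = 0) :
    outerCap κ (⋃ n, E n) = 0 := by
  refine nonpos_iff_eq_zero.1 (ENNReal.le_of_forall_pos_le_add fun ε hε _ => ?_)
  rw [zero_add]
  set η : ℝ≥0∞ := ((NNReal.sqrt ε : ℝ≥0) : ℝ≥0∞) with hη
  have hη2 : η ^ 2 = ε := by rw [hη]; exact_mod_cast NNReal.sq_sqrt ε
  have hη0 : η ≠ 0 := by simpa [hη] using hε.ne'
  obtain ⟨δ, hδ0, hδ⟩ := ENNReal.exists_pos_sum_of_countable hη0 ℕ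
  have hD : ∀ n, ∃ D : Set X, (IsOpen D ∧ E n ⊆ D) ∧ innerCap κ D < (δ n : ℝ≥0∞) ^ 2 := by
    intro n
    have : outerCap κ (E n) < (δ n : ℝ≥0∞) ^ 2 := by
      rw [hE n]
      exact pos_iff_ne_zero.2 (pow_ne_zero 2 (by exact_mod_cast (hδ0 n).ne'))
    simpa [outerCap, iInf_lt_iff] using this
  choose D hD hcap using hD
  have hle : outerCap κ (⋃ n, E n) ≤ innerCap κ (⋃ n, D n) :=
    iInf₂_le (⋃ n, D n) ⟨isOpen_iUnion fun n => (hD n).1, iUnion_mono fun n => (hD n).2⟩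
  refine hle.trans ?_
  rw [innerCap, ENNReal.inv_le_iff_inv_le, ← hη2]
  refine le_iInf₂ fun σ hσ => ?_
  obtain ⟨⟨hσE, hconc⟩, hσ1⟩ := hσ
  set s : ℝ≥0∞ := energy κ σ σ ^ (1 / 2 : ℝ) with hs
  have hs2 : s ^ 2 = energy κ σ σ := by
    rw [hs, ← ENNReal.rpow_natCast, ← ENNReal.rpow_mul]
    norm_num
  have hσD : ∀ n, σ (D n) ≤ δ n * s := by
    intro n
    have hδn : (δ n : ℝ≥0∞) ^ 2 ≠ 0 := pow_ne_zero 2 (by exact_mod_cast (hδ0 n).ne')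
    have h1 := sq_measure_mul_inv_innerCap_le (B := D n) (S := D n) hσE (hD n).1.measurableSet
      (by simp)
    have h2 : σ (D n) ^ 2 * ((δ n : ℝ≥0∞) ^ 2)⁻¹ ≤ s ^ 2 := by
      rw [hs2]
      refine le_trans ?_ h1
      gcongr
      exact (hcap n).le
    rw [← div_eq_mul_inv, ENNReal.div_le_iff hδn (by finiteness), mul_comm, ← mul_pow] at h2
    exact (ENNReal.pow_le_pow_left_iff two_ne_zero).1 h2
  have h1 : 1 ≤ η * s := by
    calc (1 : ℝ≥0∞) = σ univ := hσ1.symm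
      _ ≤ σ (⋃ n, D n) + σ (⋃ n, D n)ᶜ := by
          rw [← union_compl_self (⋃ n, D n)]; exact measure_union_le _ _
      _ = σ (⋃ n, D n) := by rw [concOn_iff.1 hconc, add_zero]
      _ ≤ ∑' n, σ (D n) := measure_iUnion_le _
      _ ≤ ∑' n, δ n * s := ENNReal.tsum_le_tsum hσD
      _ = (∑' n, (δ n : ℝ≥0∞)) * s := ENNReal.tsum_mul_right
      _ ≤ η * s := by gcongr
  have h2 : η⁻¹ ≤ s := by
    rw [ENNReal.inv_le_iff_le_mul (fun _ => hη0) (fun h => by simp [hη] at h)]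
    exact h1
  rw [← hs2, ENNReal.inv_pow]
  gcongr

end Capacity

section Vague

variable [SecondCountableTopology X] {κ : X → X → ℝ≥0∞}

open CompactlySupportedContinuousMap CompactlySupported in
/-- Vague compactness: a vaguely bounded family has a vague limit along every ultrafilter. -/
lemma exists_vagueConv {ι : Type*} (𝒰 : Ultrafilter ι) (m : ι → Measure X)
    (hb : ∀ K, IsCompact K → ∃ C : ℝ≥0∞, C ≠ ⊤ ∧ ∀ i, m i K ≤ C) :
    ∃ ν : Measure X, IsRadon ν ∧ VagueConv (𝒰 : Filter ι) m ν := by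
  have hloc : ∀ i, IsFiniteMeasureOnCompacts (m i) := fun i => ⟨fun K hK => by
    obtain ⟨C, hC, h⟩ := hb K hK
    exact (h i).trans_lt hC.lt_top⟩
  have hlim : ∀ f : C_c(X, ℝ), ∃ y, Tendsto (fun i => ∫ x, f x ∂(m i)) 𝒰 (𝓝 y) := by
    intro f
    obtain ⟨C, hC, h⟩ := hb _ f.hasCompactSupport
    obtain ⟨M, hM⟩ := f.hasCompactSupport.exists_bound_of_continuous f.continuous
    have hbound : ∀ i, ∫ x, f x ∂(m i) ∈ Metric.closedBall (0 : ℝ) (max M 0 * C.toReal) := by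
      intro i
      rw [mem_closedBall_zero_iff,
        ← setIntegral_eq_integral_of_forall_compl_eq_zero (s := tsupport f)
          fun x hx => image_eq_zero_of_notMem_tsupport hx]
      refine (norm_setIntegral_le_of_norm_le_const ((h i).trans_lt hC.lt_top)
        fun x _ => (hM x).trans (le_max_left M 0)).trans ?_
      gcongr
      exact ENNReal.toReal_mono hC (h i)
    have hmap : (𝒰.map fun i => ∫ x, f x ∂(m i) : Filter ℝ) ≤
        𝓟 (Metric.closedBall (0 : ℝ) (max M 0 * C.toReal)) := by
      simp only [le_principal_iff, Ultrafilter.mem_coe, Ultrafilter.mem_map]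
      exact univ_mem' hbound
    obtain ⟨y, -, hy⟩ := (isCompact_closedBall (0 : ℝ) (max M 0 * C.toReal)).ultrafilter_le_nhds _ hmap
    exact ⟨y, hy⟩
  choose L hL using hlim
  let Λ₀ : C_c(X, ℝ) →ₗ[ℝ] ℝ :=
    { toFun := L
      map_add' := fun f g => by
        refine tendsto_nhds_unique (hL (f + g)) (((hL f).add (hL g)).congr fun i => ?_)
        rw [← integral_add f.integrable g.integrable]
        rfl
      map_smul' := fun c f => by
        refine tendsto_nhds_unique (hL (c • f)) (((hL f).const_mul c).congr fun i => ?_)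
        rw [← integral_const_mul]
        rfl }
  let Λ : C_c(X, ℝ) →ₚ[ℝ] ℝ := PositiveLinearMap.mk₀ Λ₀ fun f hf =>
    ge_of_tendsto' (hL f) fun i => integral_nonneg fun x => hf x
  refine ⟨RealRMK.rieszMeasure Λ, isRadon_iff.2 inferInstance, fun f hf hc => ?_⟩
  have := RealRMK.integral_rieszMeasure Λ ⟨⟨f, hf⟩, hc⟩
  have h2 := hL ⟨⟨f, hf⟩, hc⟩
  change ∫ x, f x ∂_ = L _ at this
  rw [this]
  exact h2

lemma VagueConv.measure_isOpen_le {ι : Type*} {F : Filter ι} [F.NeBot] {m : ι → Measure X}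
    {ν : Measure X} (h : VagueConv F m ν) (hm : ∀ i, IsLocallyFiniteMeasure (m i))
    (hν : IsRadon ν) {O : Set X} (hO : IsOpen O) {L : ℝ≥0∞}
    (hL : Tendsto (fun i => m i O) F (𝓝 L)) : ν O ≤ L := by
  have := hν.1
  have := hν.2
  rw [hO.measurableSet.measure_eq_iSup_isCompact]
  refine iSup₂_le fun K hKO => iSup_le fun hK => ?_
  obtain ⟨f, hf1, hf0, hfc, hf⟩ := exists_continuous_one_zero_of_isCompact hK hO.isClosed_compl
    (disjoint_compl_right.mono_left hKO)
  have hint : ∀ (μ : Measure X) [IsLocallyFiniteMeasure μ],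
      ENNReal.ofReal (∫ x, f x ∂μ) = ∫⁻ x, ENNReal.ofReal (f x) ∂μ := fun μ _ =>
    ofReal_integral_eq_lintegral_ofReal (f.continuous.integrable_of_hasCompactSupport hfc)
      (Eventually.of_forall fun x => (hf x).1)
  have h1 : ν K ≤ ENNReal.ofReal (∫ x, f x ∂ν) := by
    rw [hint, ← lintegral_indicator_one hK.measurableSet]
    refine lintegral_mono fun x => ?_
    by_cases hx : x ∈ K <;> simp [hx, @hf1 x]
  have h2 : ∀ i, ENNReal.ofReal (∫ x, f x ∂(m i)) ≤ m i O := by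
    intro i
    rw [hint, ← lintegral_indicator_one hO.measurableSet]
    refine lintegral_mono fun x => ?_
    by_cases hx : x ∈ O
    · simpa [hx] using (hf x).2
    · simp [hx, hf0 (show x ∈ Oᶜ from hx)]
  exact h1.trans (le_of_tendsto_of_tendsto' (ENNReal.tendsto_ofReal (h f f.continuous hfc)) hL h2)

/-- The Riemann-type sum with mesh `δ` and `N` terms associated with the layers of `g`. -/
noncomputable def layerSum (g : X → ℝ≥0∞) (δ : ℝ≥0∞) (N : ℕ) (x : X) : ℝ≥0∞ :=
  ∑ k ∈ Finset.range N, δ * {x | (k + 1) * δ < g x}.indicator 1 x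

lemma layerSum_le (g : X → ℝ≥0∞) (δ : ℝ≥0∞) (N : ℕ) (x : X) :
    layerSum g δ N x ≤ g x ∧ layerSum g δ N x ≤ N * δ := by
  induction N with
  | zero => simp [layerSum]
  | succ N ih =>
    rw [layerSum, Finset.sum_range_succ, ← layerSum]
    by_cases h : (N + 1) * δ < g x
    · have h1 : layerSum g δ N x + δ * {x | (N + 1) * δ < g x}.indicator 1 x ≤ (N + 1) * δ := by
        rw [indicator_of_mem (by exact h), Pi.one_apply, mul_one, add_mul, one_mul]
        gcongr
        exact ih.2
      exact ⟨h1.trans h.le, by exact_mod_cast h1⟩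
    · rw [indicator_of_notMem (by exact h), mul_zero, add_zero]
      exact ⟨ih.1, ih.2.trans (by gcongr; simp)⟩

lemma min_le_layerSum_add (g : X → ℝ≥0∞) (δ : ℝ≥0∞) (N : ℕ) (x : X) :
    min (g x) ((N + 1) * δ) ≤ layerSum g δ N x + δ := by
  induction N with
  | zero => simp [layerSum]
  | succ N ih =>
    rw [layerSum, Finset.sum_range_succ, ← layerSum]
    by_cases h : (N + 1) * δ < g x
    · rw [min_eq_right h.le] at ih
      rw [indicator_of_mem (by exact h), Pi.one_apply, mul_one]
      refine (min_le_right _ _).trans ?_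
      push_cast
      rw [add_mul (_ + _), one_mul]
      gcongr
    · rw [min_eq_left (not_lt.1 h)] at ih
      rw [indicator_of_notMem (by exact h), mul_zero, add_zero]
      exact (min_le_left _ _).trans ih

lemma le_liminf_layerSum (g : X → ℝ≥0∞) (x : X) :
    g x ≤ liminf (fun n : ℕ => layerSum g ((n : ℝ≥0∞) + 1)⁻¹ ((n + 1) * (n + 1)) x) atTop := by
  refine le_of_forall_lt fun a ha => ?_
  obtain ⟨b, hab, hbg⟩ := exists_between ha
  obtain ⟨c, hbc, hcg⟩ := exists_between hbg
  refine hab.trans_le (le_liminf_of_le (by isBoundedDefault) ?_)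
  have hc : c ≠ ⊤ := hcg.ne_top
  have h1 : Tendsto (fun n : ℕ => ((n : ℝ≥0∞) + 1)) atTop (𝓝 ⊤) := by
    have := (tendsto_add_atTop_iff_nat 1).2 ENNReal.tendsto_nat_nhds_top
    simpa using this
  have h2 : Tendsto (fun n : ℕ => ((n : ℝ≥0∞) + 1)⁻¹) atTop (𝓝 0) := by
    simpa using tendsto_inv_iff.2 h1
  filter_upwards [h1.eventually (lt_mem_nhds hc.lt_top),
    h2.eventually (gt_mem_nhds (tsub_pos_of_lt hbc))] with n hn1 hn2
  have h3 := min_le_layerSum_add g ((n : ℝ≥0∞) + 1)⁻¹ ((n + 1) * (n + 1)) x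
  have h4 : c ≤ min (g x) ((((n + 1) * (n + 1) : ℕ) + 1) * ((n : ℝ≥0∞) + 1)⁻¹) := by
    refine le_min hcg.le (hn1.le.trans ?_)
    push_cast
    rw [add_mul, mul_assoc, ENNReal.mul_inv_cancel (by simp) (by finiteness), mul_one]
    exact le_self_add
  have h5 : b + (c - b) ≤ layerSum g ((n : ℝ≥0∞) + 1)⁻¹ ((n + 1) * (n + 1)) x + (c - b) := by
    rw [add_tsub_cancel_of_le hbc.le]
    exact (h4.trans h3).trans (by gcongr)
  exact (ENNReal.add_le_add_iff_right (by finiteness)).1 h5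

/-- Vague lower semicontinuity of the integral of a lower semicontinuous function. -/
lemma VagueConv.lintegral_le {ι : Type*} {𝒰 : Ultrafilter ι} {m : ι → Measure X}
    {ν : Measure X} (h : VagueConv (𝒰 : Filter ι) m ν) (hm : ∀ i, IsLocallyFiniteMeasure (m i))
    (hν : IsRadon ν) {g : X → ℝ≥0∞} (hg : LowerSemicontinuous g) {C : ℝ≥0∞}
    (hC : ∀ i, ∫⁻ x, g x ∂(m i) ≤ C) : ∫⁻ x, g x ∂ν ≤ C := by
  have hopen : ∀ t, IsOpen {x | t < g x} := fun t => hg.isOpen_preimage t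
  have hsum : ∀ (μ : Measure X) (δ : ℝ≥0∞) (N : ℕ), ∫⁻ x, layerSum g δ N x ∂μ =
      ∑ k ∈ Finset.range N, δ * μ {x | (k + 1) * δ < g x} := by
    intro μ δ N
    unfold layerSum
    rw [lintegral_finsetSum]
    · refine Finset.sum_congr rfl fun k _ => ?_
      rw [lintegral_const_mul _ (measurable_one.indicator (hopen _).measurableSet),
        lintegral_indicator_one (hopen _).measurableSet]
    · exact fun k _ => (measurable_one.indicator (hopen _).measurableSet).const_mul _
  have hmeas : ∀ δ N, Measurable (layerSum g δ N) := fun δ N =>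
    Finset.measurable_fun_sum _
      fun k _ => (measurable_one.indicator (hopen _).measurableSet).const_mul _
  have hle : ∀ (δ : ℝ≥0∞) (N : ℕ), δ ≠ ⊤ → ∫⁻ x, layerSum g δ N x ∂ν ≤ C := by
    intro δ N hδ
    have hlim : ∀ t, ∃ L, Tendsto (fun i => m i {x | t < g x}) 𝒰 (𝓝 L) := by
      intro t
      obtain ⟨L, -, hL⟩ := isCompact_univ.ultrafilter_le_nhds
        (𝒰.map fun i => m i {x | t < g x}) (by simp)
      exact ⟨L, hL⟩
    choose L hL using hlim
    rw [hsum]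
    have hterm : ∀ k : ℕ, δ * ν {x | (k + 1) * δ < g x} ≤ δ * L ((k + 1) * δ) := fun k => by
      gcongr
      exact h.measure_isOpen_le hm hν (hopen _) (hL _)
    refine (Finset.sum_le_sum fun k _ => hterm k).trans ?_
    refine le_of_tendsto' (tendsto_finsetSum _ fun k _ =>
      ENNReal.Tendsto.const_mul (hL ((k + 1) * δ)) (Or.inr hδ)) fun i => ?_
    rw [← hsum]
    exact (lintegral_mono fun x => (layerSum_le g δ N x).1).trans (hC i)
  refine (lintegral_mono (le_liminf_layerSum g)).trans
    ((lintegral_liminf_le fun n => hmeas _ _).trans ?_)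
  exact liminf_le_of_frequently_le' (Frequently.of_forall fun n => hle _ _ (by simp))

lemma VagueConv.mem_Eplus (hker : IsKernel κ) (hE : EnergyPrinciple κ) {ι : Type*}
    {𝒰 : Ultrafilter ι} {m : ι → Measure X} {ν : Measure X} (h : VagueConv (𝒰 : Filter ι) m ν)
    (hm : ∀ i, m i ∈ Eplus κ) (hν : IsRadon ν) {C : ℝ≥0∞} (hC : C ≠ ⊤)
    (hb : ∀ i, energy κ (m i) (m i) ≤ C) : ν ∈ Eplus κ := by
  have hloc : ∀ i, IsLocallyFiniteMeasure (m i) := fun i => isLocallyFiniteMeasure_of_mem (hm i)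
  have := hν.2
  have hij : ∀ i j, energy κ (m i) (m j) ≤ C := fun i j => by
    have h1 := (hE _ (hm i) _ (hm j)).1.trans (add_le_add (hb i) (hb j))
    rw [← two_mul] at h1
    exact (ENNReal.mul_le_mul_iff_right (by simp) (by simp)).1 h1
  have hνj : ∀ j, energy κ (m j) ν ≤ C := fun j => by
    rw [energy_comm hker]
    exact h.lintegral_le hloc hν (lowerSemicontinuous_pot hker _) fun i => hij i j
  exact ⟨hν, (h.lintegral_le hloc hν (lowerSemicontinuous_pot hker ν) hνj).trans_lt hC.lt_top⟩

/-- Under the density assumption, bounded energy implies vague boundedness. -/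
lemma exists_measure_le_energy_add (hE : EnergyPrinciple κ) (hA2 : A2 κ) {K : Set X}
    (hK : IsCompact K) : ∃ C : ℝ≥0∞, C ≠ ⊤ ∧ ∀ ν ∈ Eplus κ, ν K ≤ energy κ ν ν + C := by
  obtain ⟨f, hf1, -, hfc, -⟩ := exists_continuous_one_zero_of_isCompact hK isClosed_empty
    (disjoint_empty K)
  obtain ⟨-, lp, lm, -, -, hmem, -, -, -, hunif⟩ := hA2 f f.continuous hfc
  obtain ⟨j, hj⟩ := (Metric.tendstoUniformly_iff.1 hunif (1 / 2) (by norm_num)).exists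
  refine ⟨energy κ (lp j) (lp j), (hmem j).1.2.ne, fun ν hν => ?_⟩
  have hhalf : ∀ x ∈ K, 1 / 2 ≤ pot κ (lp j) x := by
    intro x hx
    have h1 := hj x
    rw [hf1 hx, Real.dist_eq, abs_lt, spot, Pi.one_apply] at h1
    have h2 : (0 : ℝ) ≤ (pot κ (lm j) x).toReal := ENNReal.toReal_nonneg
    by_cases htop : pot κ (lp j) x = ⊤
    · simp [htop]
    · rw [← ENNReal.toReal_le_toReal (by simp) htop]
      simp only [ENNReal.toReal_div, ENNReal.toReal_one, ENNReal.toReal_ofNat]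
      linarith
  have h1 : 1 / 2 * ν K ≤ energy κ ν (lp j) := by
    rw [← setLIntegral_const]
    exact (setLIntegral_mono' hK.measurableSet hhalf).trans (setLIntegral_le_lintegral _ _)
  calc ν K = 2 * (1 / 2 * ν K) := by
        rw [← mul_assoc, one_div, ENNReal.mul_inv_cancel (by simp) (by simp), one_mul]
    _ ≤ 2 * energy κ ν (lp j) := by gcongr
    _ ≤ _ := (hE ν hν _ (hmem j).1).1

end Vague

section Main

variable [SecondCountableTopology X] {κ : X → X → ℝ≥0∞}

lemma outerCap_eq_zero_of_isCompact (hker : IsKernel κ) (hE : EnergyPrinciple κ) {K : Set X}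
    (hK : IsCompact K) (h : innerCap κ K = 0) : outerCap κ K = 0 := by
  by_contra h0
  have : TopologicalSpace.MetrizableSpace X := inferInstance
  let _ := TopologicalSpace.metrizableSpaceMetric X
  obtain ⟨K', hK', hKK'⟩ := exists_compact_superset hK
  obtain ⟨f, hf1, -, hfc, -⟩ := exists_continuous_one_zero_of_isCompact hK' isClosed_empty
    (disjoint_empty K')
  let D : ℕ → Set X := fun n => Metric.thickening (1 / (n + 1 : ℝ)) K ∩ interior K'
  have hDo : ∀ n, IsOpen (D n) := fun n => Metric.isOpen_thickening.inter isOpen_interior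
  have hKD : ∀ n, K ⊆ D n := fun n =>
    subset_inter (Metric.self_subset_thickening (by positivity) K) hKK'
  set C : ℝ≥0∞ := (outerCap κ K)⁻¹ + 1 with hCdef
  have hinv : (outerCap κ K)⁻¹ ≠ ⊤ := ENNReal.inv_ne_top.2 h0
  have hC : C ≠ ⊤ := by finiteness
  have hσ : ∀ n, ∃ σ : Measure X, (σ ∈ EplusOn κ (D n) ∧ σ univ = 1) ∧ energy κ σ σ < C := by
    intro n
    have h1 : outerCap κ K ≤ innerCap κ (D n) := iInf₂_le (D n) ⟨hDo n, hKD n⟩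
    have h2 : (innerCap κ (D n))⁻¹ < C :=
      (ENNReal.inv_le_inv.2 h1).trans_lt (ENNReal.lt_add_right hinv one_ne_zero)
    rw [innerCap, inv_inv] at h2
    simpa [iInf_lt_iff] using h2
  choose σ hσ hσC using hσ
  have hσE : ∀ n, σ n ∈ Eplus κ := fun n => (hσ n).1.1
  have hσloc : ∀ n, IsLocallyFiniteMeasure (σ n) := fun n => isLocallyFiniteMeasure_of_mem (hσE n)
  have hσnull : ∀ n, σ n (D n)ᶜ = 0 := fun n => concOn_iff.1 (hσ n).1.2
  obtain ⟨ν, hν, hconv⟩ := exists_vagueConv (hyperfilter ℕ) σ fun L _ =>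
    ⟨1, ENNReal.one_ne_top, fun n => (measure_mono (subset_univ L)).trans (hσ n).2.le⟩
  have hνE : ν ∈ Eplus κ := hconv.mem_Eplus hker hE hσE hν hC fun n => (hσC n).le
  have hνK : ν Kᶜ = 0 := by
    have hsub : Kᶜ ⊆ ⋃ n : ℕ, (Metric.cthickening (1 / (n + 1 : ℝ)) K)ᶜ := by
      rw [← compl_iInter, compl_subset_compl]
      have := Metric.closure_eq_iInter_cthickening' K (range fun n : ℕ => 1 / (n + 1 : ℝ))
        fun ε hε => by
          obtain ⟨n, hn⟩ := exists_nat_one_div_lt hε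
          exact ⟨_, mem_range_self n, by positivity, hn.le⟩
      refine fun x hx => hK.isClosed.closure_eq.subset (this.symm.subset (mem_iInter₂.2 ?_))
      rintro _ ⟨n, rfl⟩
      exact mem_iInter.1 hx n
    refine measure_mono_null hsub (measure_iUnion_null fun k => nonpos_iff_eq_zero.1 ?_)
    refine hconv.measure_isOpen_le hσloc hν Metric.isClosed_cthickening.isOpen_compl
      (tendsto_const_nhds.congr' ?_)
    filter_upwards [(Nat.hyperfilter_le_atTop) (eventually_ge_atTop k)] with n hn
    refine (measure_mono_null (compl_subset_compl.2 ?_) (hσnull n)).symm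
    refine inter_subset_left.trans ((Metric.thickening_mono ?_ K).trans
      (Metric.thickening_subset_cthickening _ _))
    have : (k : ℝ) ≤ n := by exact_mod_cast hn
    gcongr
  have hν0 : ν univ = 0 := measure_eq_zero_of_innerCap_eq_zero hνE MeasurableSet.univ h
    (measure_mono_null inter_subset_right hνK)
  have hone : ∀ n, ∫ x, f x ∂(σ n) = 1 := by
    intro n
    have hae : f =ᵐ[σ n] fun _ => (1 : ℝ) := by
      refine measure_mono_null (compl_subset_compl.2 fun x hx => ?_) (hσnull n)
      exact hf1 (interior_subset hx.2)
    rw [integral_congr_ae hae]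
    simp [Measure.real, (hσ n).2]
  have hlim := hconv f f.continuous hfc
  simp only [hone] at hlim
  rw [Measure.measure_univ_eq_zero.1 hν0, integral_zero_measure] at hlim
  exact one_ne_zero (tendsto_nhds_unique tendsto_const_nhds hlim)

/-- The set where a lower semicontinuous function exceeds the supremum of countably many others is
a countable union of compact sets. -/
lemma exists_isCompact_iUnion_eq_setOf_iSup_lt {g : ℕ → X → ℝ≥0∞} {h : X → ℝ≥0∞}
    (hg : ∀ j, LowerSemicontinuous (g j)) (hh : LowerSemicontinuous h) :
    ∃ K : ℕ → Set X, (∀ n, IsCompact (K n)) ∧ ⋃ n, K n = {x | ⨆ j, g j x < h x} := by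
  have : TopologicalSpace.MetrizableSpace X := inferInstance
  let _ := TopologicalSpace.metrizableSpaceMetric X
  have hF : ∀ q : ℝ≥0∞, ∃ F : ℕ → Set X, (∀ n, IsClosed (F n)) ∧ ⋃ n, F n = {x | q < h x} :=
    fun q => by
      obtain ⟨F, h1, -, h2, -⟩ := (hh.isOpen_preimage q).exists_iUnion_isClosed
      exact ⟨F, h1, h2⟩
  choose F hFc hFu using hF
  let Q : ℚ → ℝ≥0∞ := fun q => ENNReal.ofReal q
  let T : ℚ × ℕ × ℕ → Set X := fun p =>
    compactCovering X p.2.2 ∩ (F (Q p.1) p.2.1 ∩ {x | ∀ j, g j x ≤ Q p.1})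
  obtain ⟨e, he⟩ := exists_surjective_nat (ℚ × ℕ × ℕ)
  refine ⟨T ∘ e, fun n => (isCompact_compactCovering X _).inter_right ((hFc _ _).inter ?_), ?_⟩
  · rw [show {x | ∀ j, g j x ≤ Q (e n).1} = ⋂ j, g j ⁻¹' Iic (Q (e n).1) by ext; simp]
    exact isClosed_iInter fun j => (hg j).isClosed_preimage _
  · rw [show ⋃ n, (T ∘ e) n = ⋃ p, T p from he.iUnion_comp T]
    ext x
    simp only [mem_iUnion, mem_ofPred_eq]
    constructor
    · rintro ⟨⟨q, n, k⟩, -, hx1, hx2⟩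
      have : x ∈ {x | Q q < h x} := hFu (Q q) ▸ mem_iUnion_of_mem n hx1
      exact (iSup_le hx2).trans_lt this
    · intro hx
      obtain ⟨q, -, hq1, hq2⟩ := ENNReal.lt_iff_exists_rat_btwn.1 hx
      have hxF : x ∈ ⋃ n, F (Q q) n := by rw [hFu]; exact hq2
      obtain ⟨n, hn⟩ := mem_iUnion.1 hxF
      obtain ⟨k, hk⟩ := mem_iUnion.1 (iUnion_compactCovering X ▸ mem_univ x)
      exact ⟨(q, n, k), hk, hn, fun j => (le_iSup _ j).trans hq1.le⟩

/-- Increasing potentials of a strongly convergent sequence converge quasi-everywhere. -/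
lemma outerCap_iSup_pot_lt_eq_zero (hker : IsKernel κ) (hE : EnergyPrinciple κ)
    {m : ℕ → Measure X} {β : Measure X} (hm : ∀ i, m i ∈ Eplus κ) (hβ : β ∈ Eplus κ)
    (hmono : ∀ x, Monotone fun i => pot κ (m i) x)
    (hlim : Tendsto (fun i => strDist κ (m i) β) atTop (𝓝 0)) :
    outerCap κ {x | ⨆ j, pot κ (m j) x < pot κ β x} = 0 := by
  have hloc : ∀ i, IsLocallyFiniteMeasure (m i) := fun i => isLocallyFiniteMeasure_of_mem (hm i)
  have := isLocallyFiniteMeasure_of_mem hβ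
  obtain ⟨K, hKc, hK⟩ := exists_isCompact_iUnion_eq_setOf_iSup_lt
    (fun j => lowerSemicontinuous_pot hker (m j)) (lowerSemicontinuous_pot hker β)
  rw [← hK]
  refine outerCap_iUnion_eq_zero fun n => outerCap_eq_zero_of_isCompact hker hE (hKc n) ?_
  refine innerCap_eq_zero_mono (subset_iUnion K n) ?_
  rw [hK]
  refine innerCap_eq_zero fun σ hσ h1 h0 => ?_
  have hle : ∀ᵐ x ∂σ, ⨆ j, pot κ (m j) x ≤ pot κ β x := by
    filter_upwards [show ∀ᵐ x ∂σ, ⨆ j, pot κ (m j) x < pot κ β x from h0] with x hx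
    exact hx.le
  have hint : ∫⁻ x, ⨆ j, pot κ (m j) x ∂σ = energy κ σ β := by
    rw [lintegral_iSup (fun j => measurable_pot hker _) fun i j hij x => hmono x hij]
    exact tendsto_nhds_unique (tendsto_atTop_iSup fun i j hij =>
      energy_mono_right fun x => hmono x hij) (tendsto_energy_of_strDist hker hE hm hβ hσ hlim)
  have hfin : energy κ σ β ≠ ⊤ := (energy_lt_top hE hσ hβ).ne
  have hae := ae_eq_of_ae_le_of_lintegral_le hle (hint ▸ hfin)
    (measurable_pot hker β).aemeasurable hint.ge
  have hfalse : ∀ᵐ x ∂σ, False := by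
    filter_upwards [hae, show ∀ᵐ x ∂σ, ⨆ j, pot κ (m j) x < pot κ β x from h0] with x h2 h3
    exact h3.ne h2
  have : σ univ = 0 := by simpa [ae_iff] using hfalse
  simp [this] at h1

lemma innerLam_anti {S T : Set X} (hST : S ⊆ T) (μ : Measure X) :
    InnerLam κ T μ ⊆ InnerLam κ S μ := fun ν hν =>
  ⟨hν.1, innerCap_eq_zero_mono (show {x | x ∈ S ∧ ¬ pot κ μ x ≤ pot κ ν x} ⊆
    {x | x ∈ T ∧ ¬ pot κ μ x ≤ pot κ ν x} from fun _ hx => ⟨hST hx.1, hx.2⟩) hν.2⟩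

/-- A measure whose potential dominates members of the classes `Λ` of an exhaustion belongs to the
class `Λ` of the whole set. -/
lemma mem_innerLam_of_exhaustion {A : Set X} {U : ℕ → Set X} (hUmeas : ∀ j, MeasurableSet (U j))
    (hUuniv : (⋃ j, U j) = univ) {μ β : Measure X} {b : ℕ → Measure X} (hβ : β ∈ Eplus κ)
    (hb : ∀ j, b j ∈ InnerLam κ (A ∩ U j) μ) (hle : ∀ j x, pot κ (b j) x ≤ pot κ β x) :
    β ∈ InnerLam κ A μ := by
  refine ⟨hβ, innerCap_eq_zero fun σ hσ h1 h0 => ?_⟩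
  have hU : ∀ j, σ (U j) = 0 := by
    intro j
    have hsub : U j ∩ {x | x ∈ A ∩ U j ∧ ¬ pot κ μ x ≤ pot κ (b j) x}ᶜ ⊆
        {x | x ∈ A ∧ ¬ pot κ μ x ≤ pot κ β x}ᶜ := fun x hx hx' =>
      hx.2 ⟨⟨hx'.1, hx.1⟩, fun h => hx'.2 (h.trans (hle j x))⟩
    exact measure_eq_zero_of_innerCap_eq_zero hσ (hUmeas j) (hb j).2 (measure_mono_null hsub h0)
  have : σ univ = 0 := by rw [← hUuniv]; exact measure_iUnion_null hU
  simp [this] at h1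

end Main

/-- Convergence of inner balayages along the exhaustion `A_j = A ∩ U_j`. -/
theorem statement15 [SecondCountableTopology X] (κ : X → X → ℝ≥0∞) (hker : IsKernel κ)
    (hE : EnergyPrinciple κ) (hC : Consistent κ) (hD : Domination κ) (hA2 : A2 κ)
    (A : Set X) (U : ℕ → Set X) (hUmeas : ∀ j, MeasurableSet (U j))
    (hUmono : Monotone U) (hUuniv : (⋃ j, U j) = Set.univ) :
    ∀ μ ∈ Eplus κ, ∀ bA : Measure X, IsInnerBal κ A μ bA →
      ∀ bj : ℕ → Measure X, (∀ j, IsInnerBal κ (A ∩ U j) μ (bj j)) →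
        Tendsto (fun j => strDist κ (bj j) bA) atTop (nhds (0 : ℝ)) ∧
        VagueConv atTop bj bA ∧
        ∃ E : Set X, outerCap κ E = 0 ∧
          ∀ x ∉ E, Tendsto (fun j => pot κ (bj j) x) atTop (nhds (pot κ bA x)) := by
  intro μ hμ bA hbA bj hbj
  have hAE : bA ∈ Eplus κ := hbA.1.1
  have hjE : ∀ j, bj j ∈ Eplus κ := fun j => (hbj j).1.1
  have hmono : ∀ x, Monotone fun j => pot κ (bj j) x := fun x i j hij =>
    (hbj i).2 _ (innerLam_anti (inter_subset_inter_right A (hUmono hij)) μ (hbj j).1) x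
  have hle : ∀ j x, pot κ (bj j) x ≤ pot κ bA x := fun j =>
    (hbj j).2 _ (innerLam_anti inter_subset_left μ hbA.1)
  have := isLocallyFiniteMeasure_of_mem hAE
  have hen : ∀ j, energy κ (bj j) (bj j) ≤ energy κ bA bA := fun j => by
    have := isLocallyFiniteMeasure_of_mem (hjE j)
    refine (energy_mono_right (hle j)).trans ?_
    rw [energy_comm hker]
    exact energy_mono_right (hle j)
  have hcau := strongCauchy_of_monotone_pot hker hE hjE hmono hAE.2.ne hen
  have hbdd : ∀ K, IsCompact K → ∃ C : ℝ≥0∞, C ≠ ⊤ ∧ ∀ j, bj j K ≤ C := fun K hK => by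
    obtain ⟨C, hC, h⟩ := exists_measure_le_energy_add hE hA2 hK
    exact ⟨energy κ bA bA + C, ENNReal.add_ne_top.2 ⟨hAE.2.ne, hC⟩,
      fun j => (h _ (hjE j)).trans (by gcongr; exact hen j)⟩
  have key : ∀ 𝒰 : Ultrafilter ℕ, (𝒰 : Filter ℕ) ≤ atTop →
      VagueConv (𝒰 : Filter ℕ) bj bA ∧ Tendsto (fun j => strDist κ (bj j) bA) atTop (𝓝 0) := by
    intro 𝒰 h𝒰
    obtain ⟨ν, hν, hconv⟩ := exists_vagueConv 𝒰 bj hbdd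
    have hνE : ν ∈ Eplus κ := hconv.mem_Eplus hker hE hjE hν hAE.2.ne hen
    have hstr := hC ℕ atTop bj inferInstance hjE hcau ν ⟨𝒰, h𝒰, inferInstance, hconv⟩
    have hweak : ∀ σ ∈ Eplus κ,
        Tendsto (fun j => energy κ σ (bj j)) atTop (𝓝 (energy κ σ ν)) := fun σ hσ =>
      tendsto_energy_of_strDist hker hE hjE hνE hσ hstr
    have hjν : ∀ j x, pot κ (bj j) x ≤ pot κ ν x := fun j =>
      pot_le_of_forall_energy_le hker hD (hjE j) hνE fun σ hσ =>
        Monotone.ge_of_tendsto (f := fun j => energy κ σ (bj j))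
          (fun i j hij => energy_mono_right fun x => hmono x hij) (hweak σ hσ) j
    have hνA : ∀ x, pot κ ν x ≤ pot κ bA x :=
      pot_le_of_forall_energy_le hker hD hνE hAE fun σ hσ =>
        le_of_tendsto' (hweak σ hσ) fun j => energy_mono_right (hle j)
    have hAν : ∀ x, pot κ bA x ≤ pot κ ν x :=
      hbA.2 ν (mem_innerLam_of_exhaustion hUmeas hUuniv hνE (fun j => (hbj j).1) hjν)
    obtain rfl := eq_of_pot_eq hker hE hνE hAE fun x => (hνA x).antisymm (hAν x)
    exact ⟨hconv, hstr⟩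
  have hstr := (key (hyperfilter ℕ) Nat.hyperfilter_le_atTop).2
  refine ⟨hstr, fun f hf hfc => ?_, _,
    outerCap_iSup_pot_lt_eq_zero hker hE hjE hAE hmono hstr, fun x hx => ?_⟩
  · exact tendsto_iff_ultrafilter _ _ _ |>.2 fun 𝒰 h𝒰 => (key 𝒰 h𝒰).1 f hf hfc
  · have heq : ⨆ j, pot κ (bj j) x = pot κ bA x :=
      (iSup_le fun j => hle j x).antisymm (not_lt.1 hx)
    rw [← heq]
    exact tendsto_atTop_iSup (hmono x)

end Balayage
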